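/- Let X and Y be compact Hausdorff spaces, E a closed equivalence relation on X, and F a closed equivalence relation on Y, with quotient maps π_E : X → X/E and π_F : Y → Y/F (quotient topologies). If C ⊆ X × Y is a closed set projecting onto X such that (x,y),(x',y') ∈ C and x E x' imply y F y', then the induced map f : X/E → Y/F (sending [x] to [y] for any (x,y) ∈ C) is well-defined and continuous. Conversely, for any continuous map f : X/E → Y/F, the set C = {(x,y) : f([x]) = [y]} is closed, projects onto X, and satisfies the above implication. -/

import Mathlib

theorem quotient_t2_aux {Y : Type*} [TopologicalSpace Y] [CompactSpace Y] [T2Space Y]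
    (t : Setoid Y) (ht : IsClosed {p : Y × Y | t.r p.1 p.2}) : T2Space (Quotient t) := by
  have hcont : Continuous (Quotient.mk t) := continuous_quot_mk
  have hclosed : IsClosedMap (Quotient.mk t) := by
    intro K hK
    have hq : Topology.IsQuotientMap (Quotient.mk t) := isQuotientMap_quot_mk
    rw [← hq.isClosed_preimage]
    have h : Quotient.mk t ⁻¹' (Quotient.mk t '' K)
        = Prod.snd '' ({p : Y × Y | t.r p.1 p.2} ∩ Prod.fst ⁻¹' K) := by
      ext y
      constructor
      · rintro ⟨x, hx, hxy⟩
        exact ⟨(x, y), ⟨Quotient.exact hxy, hx⟩, rfl⟩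
      · rintro ⟨⟨x, z⟩, ⟨h1, h2⟩, rfl⟩
        exact ⟨x, h2, Quotient.sound h1⟩
    rw [h]
    exact ((ht.inter (hK.preimage continuous_fst)).isCompact.image continuous_snd).isClosed
  have hproper : IsProperMap (Quotient.mk t) := by
    rw [isProperMap_iff_isClosedMap_and_compact_fibers]
    refine ⟨hcont, hclosed, fun q => ?_⟩
    obtain ⟨y, rfl⟩ := Quotient.exists_rep q
    have h : IsClosed (Quotient.mk t '' {y}) := hclosed _ isClosed_singleton
    rw [Set.image_singleton] at h
    exact (h.preimage hcont).isCompact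
  rw [t2_iff_isClosed_diagonal]
  have h := (hproper.prodMap hproper).isClosedMap _ ht
  convert h using 1
  ext ⟨a, b⟩
  constructor
  · intro hab
    obtain ⟨y, rfl⟩ := Quotient.exists_rep a
    exact ⟨(y, y), t.refl y, Prod.ext rfl hab⟩
  · rintro ⟨⟨x, y⟩, hxy, he⟩
    have h1 := congrArg Prod.fst he
    have h2 := congrArg Prod.snd he
    exact h1.symm.trans ((Quotient.sound hxy).trans h2)

/-- For closed equivalence relations on compact Hausdorff spaces,
definable maps between the quotients (with the quotient topologies) correspond
exactly to continuous maps. -/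
theorem stmt15 {X Y : Type*} [TopologicalSpace X] [CompactSpace X] [T2Space X]
    [TopologicalSpace Y] [CompactSpace Y] [T2Space Y]
    (s : Setoid X) (t : Setoid Y)
    (hs : IsClosed {p : X × X | s.r p.1 p.2}) (ht : IsClosed {p : Y × Y | t.r p.1 p.2}) :
    (∀ C : Set (X × Y), IsClosed C → (∀ x, ∃ y, (x, y) ∈ C) →
      (∀ x y x' y', (x, y) ∈ C → (x', y') ∈ C → s.r x x' → t.r y y') →
      ∃ f : Quotient s → Quotient t, Continuous f ∧
        ∀ x y, (x, y) ∈ C → f (Quotient.mk s x) = Quotient.mk t y) ∧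
    (∀ f : Quotient s → Quotient t, Continuous f →
      IsClosed {p : X × Y | f (Quotient.mk s p.1) = Quotient.mk t p.2} ∧
      (∀ x, ∃ y, f (Quotient.mk s x) = Quotient.mk t y) ∧
      (∀ x y x' y', f (Quotient.mk s x) = Quotient.mk t y →
        f (Quotient.mk s x') = Quotient.mk t y' → s.r x x' → t.r y y')) := by
  have hT := quotient_t2_aux t ht
  have hcs : Continuous (Quotient.mk s) := continuous_quot_mk
  have hct : Continuous (Quotient.mk t) := continuous_quot_mk
  refine ⟨?_, ?_⟩
  · intro C hC hsurj himp
    choose g hg using hsurj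
    have key : ∀ x y, (x, y) ∈ C → Quotient.mk t (g x) = Quotient.mk t y := fun x y h =>
      Quotient.sound (himp _ _ _ _ (hg x) h (s.refl x))
    refine ⟨Quotient.lift (fun x => Quotient.mk t (g x)) (fun a b hab =>
      Quotient.sound (himp _ _ _ _ (hg a) (hg b) hab)), ?_, key⟩
    apply Continuous.quotient_lift
    rw [continuous_iff_isClosed]
    intro K hK
    have h : (fun x => Quotient.mk t (g x)) ⁻¹' K
        = Prod.fst '' (C ∩ Prod.snd ⁻¹' (Quotient.mk t ⁻¹' K)) := by
      ext x
      constructor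
      · intro hx
        exact ⟨(x, g x), ⟨hg x, hx⟩, rfl⟩
      · rintro ⟨⟨x, y⟩, ⟨h1, h2⟩, rfl⟩
        change Quotient.mk t (g x) ∈ K
        rw [key x y h1]
        exact h2
    rw [h]
    exact ((hC.inter ((hK.preimage hct).preimage continuous_snd)).isCompact.image
      continuous_fst).isClosed
  · intro f hf
    refine ⟨isClosed_eq (hf.comp (hcs.comp continuous_fst)) (hct.comp continuous_snd), ?_, ?_⟩
    · intro x
      obtain ⟨y, hy⟩ := Quotient.exists_rep (f (Quotient.mk s x))
      exact ⟨y, hy.symm⟩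
    · intro x y x' y' h h' hx
      have e : Quotient.mk s x = Quotient.mk s x' := Quotient.sound hx
      rw [e] at h
      exact Quotient.exact (h.symm.trans h')
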